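/- arXiv:1301.7024 — 2 statements merged into one kernel-verified Lean document; each statement's English description precedes it below -/
import Mathlib

section
/- Let d be a positive even integer, A a Γ-equivalence class in F_d, and x an irrational real number. Then the map ψ sending (P, T^{−j}γ_i) to (P|T^{−j}, γ_i) is a well-defined bijection from {(P, γ) ∈ A^Red × Γ(x)′ : P(γ(∞)) < 0} onto {(P, γ) ∈ A^Sim × Γ(x) : P(γ(∞)) < 0 < P(⌊γ(x)⌋)}, with inverse (P, γ_i) ↦ (P|T^{⌊w′_P⌋+1}, T^{−⌊w′_P⌋−1}γ_i), where w′_P is the larger real root of P when P(∞) > 0. -/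
open Polynomial Matrix

noncomputable section

abbrev Mat2 := Matrix (Fin 2) (Fin 2) ℤ

/-- The matrix `Tⁿ = [[1,n],[0,1]]`. -/
def Tpow (n : ℤ) : Mat2 := !![1, n; 0, 1]

/-- The matrix `ε = [[0,1],[1,0]]`. -/
def Meps : Mat2 := !![0, 1; 1, 0]

/-- The matrix `S = [[0,-1],[1,0]]`. -/
def MS : Mat2 := !![0, -1; 1, 0]

/-- The matrix `T = [[1,1],[0,1]]`. -/
def MT : Mat2 := !![1, 1; 0, 1]

/-- The matrix `σ = [[-1,0],[0,1]]`. -/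
def Msig : Mat2 := !![-1, 0; 0, 1]

/-- The matrix `U = TS = [[1,-1],[1,0]]`. -/
def MU : Mat2 := MT * MS

/-- Möbius action of an integer matrix on a real number. -/
def moeb (M : Mat2) (x : ℝ) : ℝ :=
  ((M 0 0 : ℝ) * x + (M 0 1 : ℝ)) / ((M 1 0 : ℝ) * x + (M 1 1 : ℝ))

/-- The sequence `x_i` of the (positive) continued fraction algorithm:
`x_0 = x`, `x_{i+1} = 1/(x_i - ⌊x_i⌋)`. -/
def cfX (x : ℝ) : ℕ → ℝ
  | 0 => x
  | i + 1 => 1 / (cfX x i - (⌊cfX x i⌋ : ℝ))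

/-- The partial quotients `n_i = ⌊x_i⌋` of the continued fraction of `x`. -/
def cfN (x : ℝ) (i : ℕ) : ℤ := ⌊cfX x i⌋

/-- The matrices `γ_0 = Id`, `γ_{i+1} = ε T^{-n_i} γ_i`. -/
def gam (x : ℝ) : ℕ → Mat2
  | 0 => 1
  | i + 1 => (Meps * Tpow (-(cfN x i))) * gam x i

/-- `Γ(x) = {γ_1, γ_2, γ_3, …}`. -/
def GammaSet (x : ℝ) : Set Mat2 := {M | ∃ i, 1 ≤ i ∧ M = gam x i}

/-- The matrices `γ'_0 = Id`, `γ'_{i+1} = Tγ'_i` if `γ'_i(x) ≤ 0`,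
`T^{-1}εγ'_i` if `0 < γ'_i(x) ≤ 1`, and `T^{-1}γ'_i` if `γ'_i(x) > 1`. -/
def gam' (x : ℝ) : ℕ → Mat2
  | 0 => 1
  | i + 1 =>
    if moeb (gam' x i) x ≤ 0 then MT * gam' x i
    else if moeb (gam' x i) x ≤ 1 then (Tpow (-1) * Meps) * gam' x i
    else Tpow (-1) * gam' x i

/-- `Γ(x)' = {γ'_1, γ'_2, γ'_3, …}`. -/
def GammaSet' (x : ℝ) : Set Mat2 := {M | ∃ i, 1 ≤ i ∧ M = gam' x i}

/-- The sequence `x_i` of the negative continued fraction algorithm: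
`x_0 = x`, `x_{i+1} = 1/(⌈x_i⌉ - x_i)`. -/
def ncfX (x : ℝ) : ℕ → ℝ
  | 0 => x
  | i + 1 => 1 / ((⌈ncfX x i⌉ : ℝ) - ncfX x i)

/-- The partial quotients `m_i = ⌈x_i⌉` of the negative continued fraction of `x`. -/
def ncfM (x : ℝ) (i : ℕ) : ℤ := ⌈ncfX x i⌉

/-- The matrices `γ̃_0 = Id`, `γ̃_{i+1} = S T^{-m_i} γ̃_i`. -/
def gamt (x : ℝ) : ℕ → Mat2
  | 0 => 1
  | i + 1 => (MS * Tpow (-(ncfM x i))) * gamt x i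

/-- `Γ₁(x) = {γ̃_1, γ̃_2, γ̃_3, …}`. -/
def Gamma1Set (x : ℝ) : Set Mat2 := {M | ∃ i, 1 ≤ i ∧ M = gamt x i}

/-- A binary quadratic polynomial `aX² + bX + c`, encoded as the triple `(a,b,c)`. -/
abbrev QF := ℤ × ℤ × ℤ

/-- The value of `aX² + bX + c` at a real number `x`. -/
def Qval (q : QF) (x : ℝ) : ℝ := (q.1 : ℝ) * x ^ 2 + (q.2.1 : ℝ) * x + (q.2.2 : ℝ)

/-- The value of `aX² + bX + c` at an integer `m`. -/
def QvalZ (q : QF) (m : ℤ) : ℤ := q.1 * m ^ 2 + q.2.1 * m + q.2.2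

/-- The discriminant `b² - 4ac`. -/
def Qdisc (q : QF) : ℤ := q.2.1 ^ 2 - 4 * q.1 * q.2.2

/-- The homogenized value `a r² + b r t + c t²`; for `t ≠ 0` its sign is that of `Q(r/t)`,
and for `t = 0` that of the leading coefficient, i.e. of `Q(∞)`. -/
def Qhom (q : QF) (r t : ℤ) : ℤ := q.1 * r ^ 2 + q.2.1 * r * t + q.2.2 * t ^ 2

/-- The weight 2 action `(Q|γ)(X) = (tX+u)² Q((rX+s)/(tX+u))` on quadratic polynomials,
for `γ = [[r,s],[t,u]]`. -/
def qslash (M : Mat2) (q : QF) : QF :=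
  (Qhom q (M 0 0) (M 1 0),
   2 * q.1 * M 0 0 * M 0 1 + q.2.1 * (M 0 0 * M 1 1 + M 0 1 * M 1 0) + 2 * q.2.2 * M 1 0 * M 1 1,
   Qhom q (M 0 1) (M 1 1))

/-- The set `𝒬` of integral quadratic polynomials with positive non-square discriminant. -/
def Qset : Set QF := {q | 0 < Qdisc q ∧ ¬ IsSquare (Qdisc q)}

/-- `A` is a `Γ`-equivalence class in `𝒬`, where `Γ = PGL₂(ℤ)`. -/
def IsClassQ (A : Set QF) : Prop :=
  ∃ q₀ ∈ Qset, A = {q ∈ Qset | ∃ M : Mat2, IsUnit M.det ∧ q = qslash M q₀}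

/-- `B` is a `Γ₁`-equivalence class in `𝒬`, where `Γ₁ = PSL₂(ℤ)`. -/
def IsClassQ1 (B : Set QF) : Prop :=
  ∃ q₀ ∈ Qset, B = {q ∈ Qset | ∃ M : Mat2, M.det = 1 ∧ q = qslash M q₀}

/-- `A^Sim = {Q ∈ A : Q(0) < 0 < Q(∞)}`. -/
def QSim (A : Set QF) : Set QF := {q ∈ A | q.2.2 < 0 ∧ 0 < q.1}

/-- `A^Red = {Q ∈ A : Q(∞) > 0, Q(-1) < 0 < Q(0)}`. -/
def QRed (A : Set QF) : Set QF := {q ∈ A | 0 < q.1 ∧ q.1 - q.2.1 + q.2.2 < 0 ∧ 0 < q.2.2}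

/-- `A⟨x⟩ = {Q ∈ A : Q(∞) < 0 < Q(x)}`. -/
def QxSet (A : Set QF) (x : ℝ) : Set QF := {q ∈ A | q.1 < 0 ∧ 0 < Qval q x}

/-- `𝒬_D⟨x⟩`, the set of quadratics of discriminant `D` with `Q(∞) < 0 < Q(x)`. -/
def QDx (D : ℕ) (x : ℝ) : Set QF :=
  {q | Qdisc q = (D : ℤ) ∧ q.1 < 0 ∧ 0 < Qval q x}

/-- The simple forms of discriminant `D`: `a > 0 > c`. -/
def SimpleD (D : ℕ) : Set QF := {q | Qdisc q = (D : ℤ) ∧ 0 < q.1 ∧ q.2.2 < 0}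

/-- The reduced forms of discriminant `D`: `a > 0`, `c > 0`, `b > a + c`. -/
def ReducedD (D : ℕ) : Set QF :=
  {q | Qdisc q = (D : ℤ) ∧ 0 < q.1 ∧ 0 < q.2.2 ∧ q.1 + q.2.2 < q.2.1}

/-- Homogenized evaluation of a polynomial of degree ≤ d: `∑ P_j r^j t^{d-j}`;
for `t ≠ 0` its sign is that of `P(r/t)` (`d` even), and for `t = 0` that of `P(∞)`. -/
def homEval (d : ℕ) (P : Polynomial ℤ) (r t : ℤ) : ℤ :=
  ∑ j ∈ Finset.range (d + 1), P.coeff j * r ^ j * t ^ (d - j)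

/-- The weight `d` action `(P|γ)(X) = (tX+u)^d P((rX+s)/(tX+u))` on integral polynomials
of degree at most `d`, for `γ = [[r,s],[t,u]]`. -/
def pslash (d : ℕ) (M : Mat2) (P : Polynomial ℤ) : Polynomial ℤ :=
  ∑ j ∈ Finset.range (d + 1),
    C (P.coeff j) * (C (M 0 0) * X + C (M 0 1)) ^ j * (C (M 1 0) * X + C (M 1 1)) ^ (d - j)

/-- `P` has exactly two real roots `w ≠ w'`, both irrational. -/
def HasTwoIrratRoots (P : Polynomial ℤ) (w w' : ℝ) : Prop :=
  w ≠ w' ∧ Irrational w ∧ Irrational w' ∧ ∀ y : ℝ, Polynomial.aeval y P = 0 ↔ y = w ∨ y = w'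

/-- `F_d`: integral polynomials of degree ≤ d with exactly two real roots, both irrational. -/
def Fd (d : ℕ) : Set (Polynomial ℤ) :=
  {P | P.natDegree ≤ d ∧ ∃ w w' : ℝ, HasTwoIrratRoots P w w'}

/-- `A` is a `Γ`-equivalence class in `F_d`, where `Γ = PGL₂(ℤ)`. -/
def IsClassF (d : ℕ) (A : Set (Polynomial ℤ)) : Prop :=
  ∃ P₀ ∈ Fd d, A = {P ∈ Fd d | ∃ M : Mat2, IsUnit M.det ∧ P = pslash d M P₀}

/-- `B` is a `Γ₁`-equivalence class in `F_d`, where `Γ₁ = PSL₂(ℤ)`. -/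
def IsClassF1 (d : ℕ) (B : Set (Polynomial ℤ)) : Prop :=
  ∃ P₀ ∈ Fd d, B = {P ∈ Fd d | ∃ M : Mat2, M.det = 1 ∧ P = pslash d M P₀}

/-- `A^Sim = {P ∈ A : P(0) < 0 < P(∞)}`, where `P(∞)` is the coefficient of `X^d`. -/
def PSim (d : ℕ) (A : Set (Polynomial ℤ)) : Set (Polynomial ℤ) :=
  {P ∈ A | P.coeff 0 < 0 ∧ 0 < P.coeff d}

/-- `A^Red = {P ∈ A : P(∞) > 0 and P(-1) < 0 < P(0)}`. -/
def PRed (d : ℕ) (A : Set (Polynomial ℤ)) : Set (Polynomial ℤ) :=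
  {P ∈ A | 0 < P.coeff d ∧ Polynomial.aeval (-1 : ℤ) P < 0 ∧ 0 < P.coeff 0}

/-- `A⟨x⟩ = {P ∈ A : P(∞) < 0 < P(x)}`. -/
def Px (d : ℕ) (A : Set (Polynomial ℤ)) (x : ℝ) : Set (Polynomial ℤ) :=
  {P ∈ A | P.coeff d < 0 ∧ 0 < Polynomial.aeval x P}

/-- The numerators of the convergents, shifted by 2: `pconv x i = p_{i-2}`. -/
def pconv (x : ℝ) : ℕ → ℤ
  | 0 => 0
  | 1 => 1
  | i + 2 => cfN x i * pconv x (i + 1) + pconv x i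

/-- The denominators of the convergents, shifted by 2: `qconv x i = q_{i-2}`. -/
def qconv (x : ℝ) : ℕ → ℤ
  | 0 => 1
  | 1 => 0
  | i + 2 => cfN x i * qconv x (i + 1) + qconv x i

/-- `δ_i = (-1)^i (p_{i-1} - q_{i-1} x)` for `i ≥ 0`. -/
def cfDelta (x : ℝ) (i : ℕ) : ℝ :=
  (-1 : ℝ) ^ i * ((pconv x (i + 1) : ℝ) - (qconv x (i + 1) : ℝ) * x)

/-- The weight `d` action `(P|γ)(X) = (tX+u)^d P((rX+s)/(tX+u))` on complex polynomials
of degree at most `d`, for `γ = [[r,s],[t,u]]` with integer entries. -/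
def cslash (d : ℕ) (M : Mat2) (P : Polynomial ℂ) : Polynomial ℂ :=
  ∑ j ∈ Finset.range (d + 1),
    C (P.coeff j) * (C (M 0 0 : ℂ) * X + C (M 0 1 : ℂ)) ^ j *
      (C (M 1 0 : ℂ) * X + C (M 1 1 : ℂ)) ^ (d - j)

/-- `P^Γ(x) = ∑_{γ ∈ Γ(x)} (P|γ)(x)` for `P` of degree ≤ 2k. -/
def PGam (k : ℕ) (P : Polynomial ℂ) (x : ℝ) : ℂ :=
  ∑' γ : GammaSet x, Polynomial.eval (x : ℂ) (cslash (2 * k) γ.1 P)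

/-- The left-hand set `{(P,γ) ∈ A^Red × Γ(x)' : P(γ(∞)) < 0}`, with
`Γ(x)' = {T^{-j}γ_i : i ≥ 1, 1 ≤ j ≤ n_i}`. -/
def RedTjPairs (d : ℕ) (A : Set (Polynomial ℤ)) (x : ℝ) : Set (Polynomial ℤ × Mat2) :=
  {pg | pg.1 ∈ PRed d A ∧
    (∃ i j : ℕ, 1 ≤ i ∧ 1 ≤ j ∧ (j : ℤ) ≤ cfN x i ∧ pg.2 = Tpow (-(j : ℤ)) * gam x i) ∧
    homEval d pg.1 (pg.2 0 0) (pg.2 1 0) < 0}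

/-- The right-hand set `{(P,γ) ∈ A^Sim × Γ(x) : P(γ(∞)) < 0 < P(⌊γ(x)⌋)}`. -/
def SimFlPairs (d : ℕ) (A : Set (Polynomial ℤ)) (x : ℝ) : Set (Polynomial ℤ × Mat2) :=
  {pg | pg.1 ∈ PSim d A ∧ pg.2 ∈ GammaSet x ∧
    homEval d pg.1 (pg.2 0 0) (pg.2 1 0) < 0 ∧
    0 < Polynomial.aeval (⌊moeb pg.2 x⌋ : ℤ) pg.1}

theorem pslash_Tpow {d : ℕ} {P : ℤ[X]} (hP : P.natDegree ≤ d) (n : ℤ) :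
    pslash d (Tpow n) P = P.comp (X + C n) := by
  rw [Polynomial.comp, eval₂_eq_sum_range' C (Nat.lt_succ_of_le hP)]
  simp [pslash, Tpow]

theorem pslash_mul_Tpow (d : ℕ) (M : Mat2) (P : ℤ[X]) (n : ℤ) :
    pslash d (M * Tpow n) P = (pslash d M P).comp (X + C n) := by
  simp only [pslash, Polynomial.sum_comp, mul_comp, pow_comp, add_comp, C_comp, X_comp, Tpow,
    Matrix.mul_apply, Fin.sum_univ_two]
  refine Finset.sum_congr rfl fun j _ => ?_
  simp [mul_add, add_assoc]

theorem comp_X_add_C_comp_X_add_C (P : ℤ[X]) (m n : ℤ) :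
    (P.comp (X + C m)).comp (X + C n) = P.comp (X + C (m + n)) := by
  rw [comp_assoc]
  congr 1
  simp only [add_comp, X_comp, C_comp, C_add]
  ring

theorem natDegree_comp_X_add_C_le {d : ℕ} {P : ℤ[X]} (hP : P.natDegree ≤ d) (n : ℤ) :
    (P.comp (X + C n)).natDegree ≤ d := by
  rw [natDegree_comp, natDegree_X_add_C, mul_one]
  exact hP

theorem natDegree_eq_of_coeff_pos {d : ℕ} {P : ℤ[X]} (hP : P.natDegree ≤ d)
    (hc : 0 < P.coeff d) : P.natDegree = d :=
  le_antisymm hP (le_natDegree_of_ne_zero hc.ne')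

theorem coeff_comp_X_add_C_pos {d : ℕ} {P : ℤ[X]} (hP : P.natDegree ≤ d)
    (hc : 0 < P.coeff d) (n : ℤ) : 0 < (P.comp (X + C n)).coeff d := by
  have h := natDegree_eq_of_coeff_pos hP hc
  subst h
  rw [← taylor_apply, coeff_taylor_natDegree]
  exact hc

theorem aeval_real_comp_X_add_C (P : ℤ[X]) (n : ℤ) (y : ℝ) :
    aeval y (P.comp (X + C n)) = aeval (y + n) P := by
  simp [aeval_comp]

theorem cast_aeval_int (P : ℤ[X]) (m : ℤ) :
    ((aeval m P : ℤ) : ℝ) = aeval (m : ℝ) P := by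
  simpa using (aeval_algebraMap_apply ℝ m P).symm

theorem cast_coeff_zero (P : ℤ[X]) : ((P.coeff 0 : ℤ) : ℝ) = aeval (0 : ℝ) P := by
  have h := cast_aeval_int P 0
  rw [← coeff_zero_eq_aeval_zero] at h
  simpa using h

theorem HasTwoIrratRoots.comp_X_add_C {P : ℤ[X]} {w w' : ℝ} (h : HasTwoIrratRoots P w w')
    (n : ℤ) : HasTwoIrratRoots (P.comp (X + C n)) (w - n) (w' - n) := by
  obtain ⟨h1, h2, h3, h4⟩ := h
  refine ⟨fun e => h1 (by linarith), h2.sub_intCast n, h3.sub_intCast n, fun y => ?_⟩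
  rw [aeval_real_comp_X_add_C, h4, eq_sub_iff_add_eq, eq_sub_iff_add_eq]

theorem IsClassF.comp_X_add_C_mem {d : ℕ} {A : Set ℤ[X]} (hA : IsClassF d A) {P : ℤ[X]}
    (hP : P ∈ A) (n : ℤ) : P.comp (X + C n) ∈ A := by
  obtain ⟨P₀, -, rfl⟩ := hA
  obtain ⟨⟨hdeg, w, w', hw⟩, M, hM, rfl⟩ := hP
  refine ⟨⟨natDegree_comp_X_add_C_le hdeg n, _, _, hw.comp_X_add_C n⟩, M * Tpow n, ?_,
    (pslash_mul_Tpow d M P₀ n).symm⟩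
  have : (Tpow n).det = 1 := by simp [Tpow, Matrix.det_fin_two]
  rwa [Matrix.det_mul, this, mul_one]

theorem IsClassF.mem_Fd {d : ℕ} {A : Set ℤ[X]} (hA : IsClassF d A) {P : ℤ[X]}
    (hP : P ∈ A) : P ∈ Fd d := by
  obtain ⟨P₀, -, rfl⟩ := hA
  exact hP.1

theorem exists_gt_aeval_pos {P : ℤ[X]} (hd : 0 < P.natDegree) (hc : 0 < P.leadingCoeff)
    (y : ℝ) : ∃ b, y < b ∧ 0 < aeval b P := by
  have hinj : Function.Injective (algebraMap ℤ ℝ) := Int.cast_injective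
  have ht := tendsto_atTop_of_leadingCoeff_nonneg (P.map (algebraMap ℤ ℝ))
    (by rw [← natDegree_pos_iff_degree_pos, natDegree_map_eq_of_injective hinj]; exact hd)
    (by rw [leadingCoeff_map_of_injective hinj]; simpa using hc.le)
  obtain ⟨b, h1, h2⟩ :=
    ((Filter.eventually_gt_atTop y).and (ht.eventually_gt_atTop 0)).exists
  exact ⟨b, h1, by rwa [eval_map_algebraMap] at h2⟩

theorem exists_lt_aeval_pos {P : ℤ[X]} (hd : 0 < P.natDegree) (he : Even P.natDegree)
    (hc : 0 < P.leadingCoeff) (y : ℝ) : ∃ b, b < y ∧ 0 < aeval b P := by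
  obtain ⟨b, h1, h2⟩ := exists_gt_aeval_pos (P := P.comp (-X))
    (by rw [natDegree_comp, natDegree_neg, natDegree_X, mul_one]; exact hd)
    (by
      rw [leadingCoeff_comp (by simp)]
      simpa [he.neg_one_pow] using hc) (-y)
  exact ⟨-b, by linarith, by simpa [aeval_comp] using h2⟩

theorem exists_aeval_eq_zero_between (P : ℤ[X]) {a b : ℝ} (ha : aeval a P < 0)
    (hb : 0 < aeval b P) : ∃ c ∈ Set.uIcc a b, aeval c P = 0 :=
  intermediate_value_uIcc (P.continuous_aeval.continuousOn)
    (Set.mem_uIcc_of_le ha.le hb.le)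

theorem exists_roots_of_aeval_neg {d : ℕ} (hd : 0 < d) (hde : Even d) {P : ℤ[X]}
    (hP : P ∈ Fd d) (hc : 0 < P.coeff d) {m : ℝ} (hm : aeval m P < 0) :
    ∃ w w' : ℝ, w < w' ∧ HasTwoIrratRoots P w w' ∧
      ∀ y : ℝ, aeval y P < 0 ↔ w < y ∧ y < w' := by
  obtain ⟨hdeg, v, v', hv⟩ := hP
  have hn := natDegree_eq_of_coeff_pos hdeg hc
  have hlc : 0 < P.leadingCoeff := by rwa [leadingCoeff, hn]
  wlog hlt : v < v' generalizing v v'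
  · refine this v' v ⟨hv.1.symm, hv.2.2.1, hv.2.1, fun y => ?_⟩
      (lt_of_le_of_ne (not_lt.mp hlt) hv.1.symm)
    rw [hv.2.2.2, or_comm]
  have key : ∀ y : ℝ, aeval y P < 0 → v < y ∧ y < v' := by
    intro y hy
    constructor
    · by_contra! h
      obtain ⟨b, hb, hb'⟩ := exists_lt_aeval_pos (hn ▸ hd) (hn ▸ hde) hlc y
      obtain ⟨c, hcm, hc0⟩ := exists_aeval_eq_zero_between P hy hb'
      rw [Set.uIcc_of_ge hb.le] at hcm
      have hcy : c ≠ y := fun e => by rw [← e, hc0] at hy; exact lt_irrefl _ hy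
      have := lt_of_le_of_ne hcm.2 hcy
      rcases (hv.2.2.2 c).1 hc0 with rfl | rfl <;> linarith
    · by_contra! h
      obtain ⟨b, hb, hb'⟩ := exists_gt_aeval_pos (hn ▸ hd) hlc y
      obtain ⟨c, hcm, hc0⟩ := exists_aeval_eq_zero_between P hy hb'
      rw [Set.uIcc_of_le hb.le] at hcm
      have hcy : c ≠ y := fun e => by rw [← e, hc0] at hy; exact lt_irrefl _ hy
      have := lt_of_le_of_ne hcm.1 hcy.symm
      rcases (hv.2.2.2 c).1 hc0 with rfl | rfl <;> linarith
  refine ⟨v, v', hlt, hv, fun y => ⟨key y, fun ⟨h1, h2⟩ => ?_⟩⟩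
  by_contra! h
  have hpos : 0 < aeval y P := lt_of_le_of_ne h fun e => by
    rcases (hv.2.2.2 y).1 e.symm with rfl | rfl <;> linarith
  obtain ⟨c, hcm, hc0⟩ := exists_aeval_eq_zero_between P hm hpos
  have hcm' : c ∈ Set.Ioo v v' := Set.ordConnected_Ioo.uIcc_subset (key m hm) ⟨h1, h2⟩ hcm
  rcases (hv.2.2.2 c).1 hc0 with rfl | rfl
  · exact lt_irrefl _ hcm'.1
  · exact lt_irrefl _ hcm'.2

theorem homEval_neg_iff {d : ℕ} (hde : Even d) {P : ℤ[X]} (hP : P.natDegree ≤ d) (r : ℤ)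
    {t : ℤ} (ht : t ≠ 0) : homEval d P r t < 0 ↔ aeval ((r : ℝ) / t) P < 0 := by
  have ht' : (t : ℝ) ≠ 0 := by exact_mod_cast ht
  have h : ((homEval d P r t : ℤ) : ℝ) = (t : ℝ) ^ d * aeval ((r : ℝ) / t) P := by
    rw [aeval_eq_sum_range' (Nat.lt_succ_of_le hP), Finset.mul_sum, homEval, Int.cast_sum]
    refine Finset.sum_congr rfl fun j hj => ?_
    have hjd : j ≤ d := Nat.lt_succ_iff.mp (Finset.mem_range.mp hj)
    rw [zsmul_eq_mul, div_pow, ← Nat.sub_add_cancel hjd, pow_add]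
    push_cast
    simp only [Nat.add_sub_cancel]
    field_simp
  rw [← Int.cast_lt (R := ℝ), h, Int.cast_zero, mul_neg_iff]
  have hpos := hde.pow_pos ht'
  constructor
  · rintro (h | h)
    · exact h.2
    · linarith [h.1]
  · exact fun h => Or.inl ⟨hpos, h⟩

theorem irrational_cfX {x : ℝ} (hx : Irrational x) (i : ℕ) : Irrational (cfX x i) := by
  induction i with
  | zero => exact hx
  | succ i ih =>
    rw [cfX, one_div]
    exact (ih.sub_intCast _).inv

theorem cfX_sub_cfN_mem {x : ℝ} (hx : Irrational x) (i : ℕ) :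
    0 < cfX x i - cfN x i ∧ cfX x i - cfN x i < 1 := by
  refine ⟨sub_pos.2 (lt_of_le_of_ne (Int.floor_le _) fun e => ?_), ?_⟩
  · exact (irrational_cfX hx i).ne_int _ e.symm
  · have := Int.lt_floor_add_one (cfX x i)
    rw [cfN]
    linarith

theorem one_le_cfN {x : ℝ} (hx : Irrational x) {i : ℕ} (hi : 1 ≤ i) : 1 ≤ cfN x i := by
  obtain ⟨k, rfl⟩ := Nat.exists_eq_add_of_le' hi
  obtain ⟨h0, h1⟩ := cfX_sub_cfN_mem hx k
  rw [cfN, Int.le_floor, cfX, Int.cast_one]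
  exact (one_le_div h0).2 h1.le

theorem gam_succ_apply (x : ℝ) (i : ℕ) (k : Fin 2) :
    gam x (i + 1) 0 k = gam x i 1 k ∧
      gam x (i + 1) 1 k = gam x i 0 k - cfN x i * gam x i 1 k := by
  constructor <;> simp [gam, Meps, Tpow, Matrix.mul_apply, Fin.sum_univ_two, sub_eq_add_neg]

theorem gam_apply_linear {x : ℝ} (hx : Irrational x) (i : ℕ) :
    (gam x i 0 0 * x + gam x i 0 1 : ℝ) = cfX x i * (gam x i 1 0 * x + gam x i 1 1) ∧
      (0 : ℝ) < gam x i 1 0 * x + gam x i 1 1 := by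
  induction i with
  | zero => simp [gam, cfX]
  | succ i ih =>
    obtain ⟨h0, -⟩ := cfX_sub_cfN_mem hx i
    obtain ⟨ih1, ih2⟩ := ih
    simp only [gam_succ_apply, Int.cast_sub, Int.cast_mul]
    have e : ((gam x i 0 0 : ℝ) - cfN x i * gam x i 1 0) * x
        + ((gam x i 0 1 : ℝ) - cfN x i * gam x i 1 1)
        = (cfX x i - cfN x i) * (gam x i 1 0 * x + gam x i 1 1) := by
      linear_combination ih1
    rw [e]
    refine ⟨?_, mul_pos h0 ih2⟩
    have : cfX x (i + 1) = 1 / (cfX x i - cfN x i) := rfl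
    rw [this]
    field_simp

theorem moeb_gam {x : ℝ} (hx : Irrational x) (i : ℕ) : moeb (gam x i) x = cfX x i := by
  obtain ⟨h1, h2⟩ := gam_apply_linear hx i
  rw [moeb, h1, mul_div_cancel_right₀ _ h2.ne']

theorem strictAnti_gam_denom {x : ℝ} (hx : Irrational x) :
    StrictAnti fun i => (gam x i 1 0 * x + gam x i 1 1 : ℝ) := by
  refine strictAnti_nat_of_succ_lt fun i => ?_
  obtain ⟨-, hlt⟩ := cfX_sub_cfN_mem hx i
  obtain ⟨h1, h2⟩ := gam_apply_linear hx i
  simp only [gam_succ_apply, Int.cast_sub, Int.cast_mul]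
  nlinarith [mul_lt_mul_of_pos_right hlt h2]

theorem gam_one_zero_ne_zero {x : ℝ} (hx : Irrational x) {i : ℕ} (hi : 1 ≤ i) :
    gam x i 1 0 ≠ 0 ∧ gam x i 0 0 * gam x i 1 0 ≤ 0 := by
  induction i, hi using Nat.le_induction with
  | base =>
    obtain ⟨h0, h1⟩ := gam_succ_apply x 0 0
    rw [h0, h1]
    simp [gam]
  | succ i hi ih =>
    obtain ⟨h1, h2⟩ := ih
    have hn := one_le_cfN hx hi
    have hc : 0 < gam x i 1 0 ^ 2 := by positivity
    simp only [gam_succ_apply]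
    constructor
    · intro e
      rw [sub_eq_zero] at e
      rw [e] at h2
      nlinarith [mul_pos (by linarith : 0 < cfN x i) hc]
    · nlinarith [mul_pos (by linarith : 0 < cfN x i) hc]

theorem gam_infty_nonpos {x : ℝ} (hx : Irrational x) {i : ℕ} (hi : 1 ≤ i) :
    (gam x i 0 0 : ℝ) / gam x i 1 0 ≤ 0 := by
  obtain ⟨-, h⟩ := gam_one_zero_ne_zero hx hi
  have h' : (gam x i 0 0 : ℝ) * gam x i 1 0 ≤ 0 := by exact_mod_cast h
  exact div_nonpos_iff.2 (by simpa only [ge_iff_le] using mul_nonpos_iff.1 h')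

theorem Tpow_mul_apply (n : ℤ) (M : Mat2) (k : Fin 2) :
    (Tpow n * M) 0 k = M 0 k + n * M 1 k ∧ (Tpow n * M) 1 k = M 1 k := by
  constructor <;> simp [Tpow, Matrix.mul_apply, Fin.sum_univ_two]

theorem Tpow_mul_gam_inj {x : ℝ} (hx : Irrational x) {i i' : ℕ} {m m' : ℤ} (hi : 1 ≤ i)
    (h : Tpow m * gam x i = Tpow m' * gam x i') : i = i' ∧ m = m' := by
  have h1 : ∀ k, gam x i 1 k = gam x i' 1 k := fun k => by
    rw [← (Tpow_mul_apply m (gam x i) k).2, h, (Tpow_mul_apply m' _ k).2]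
  have hii : i = i' := (strictAnti_gam_denom hx).injective (by simp only [h1])
  subst hii
  refine ⟨rfl, ?_⟩
  have h2 := congrFun (congrFun h 0) 0
  rw [(Tpow_mul_apply m _ 0).1, (Tpow_mul_apply m' _ 0).1] at h2
  exact mul_right_cancel₀ (gam_one_zero_ne_zero hx hi).1 (add_left_cancel h2)

theorem homEval_Tpow_mul_gam_neg_iff {d : ℕ} (hde : Even d) {P : ℤ[X]}
    (hP : P.natDegree ≤ d) {x : ℝ} (hx : Irrational x) {i : ℕ} (hi : 1 ≤ i) (n : ℤ) :
    homEval d P ((Tpow n * gam x i) 0 0) ((Tpow n * gam x i) 1 0) < 0 ↔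
      aeval ((gam x i 0 0 : ℝ) / gam x i 1 0 + n) P < 0 := by
  have hc := (gam_one_zero_ne_zero hx hi).1
  have hc' : (gam x i 1 0 : ℝ) ≠ 0 := by exact_mod_cast hc
  rw [(Tpow_mul_apply n _ 0).1, (Tpow_mul_apply n _ 0).2, homEval_neg_iff hde hP _ hc]
  push_cast
  rw [add_div, mul_div_cancel_right₀ _ hc']

theorem RedTjPairs_slash_mem {d : ℕ} (hd : 0 < d) (hde : Even d) {A : Set ℤ[X]}
    (hA : IsClassF d A) {x : ℝ} (hx : Irrational x) {P : ℤ[X]} {i j : ℕ} (hi : 1 ≤ i)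
    (hj : 1 ≤ j) (hjn : (j : ℤ) ≤ cfN x i)
    (h : (P, Tpow (-(j : ℤ)) * gam x i) ∈ RedTjPairs d A x) :
    (pslash d (Tpow (-(j : ℤ))) P, gam x i) ∈ SimFlPairs d A x ∧
      ∃ w w' : ℝ, w < w' ∧ HasTwoIrratRoots (pslash d (Tpow (-(j : ℤ))) P) w w' ∧
        ⌊w'⌋ + 1 = (j : ℤ) := by
  obtain ⟨⟨hPA, hlead, hm1, h0⟩, -, hneg⟩ := h
  simp only at hPA hlead hm1 h0 hneg
  have hF := hA.mem_Fd hPA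
  rw [← Int.cast_lt (R := ℝ), cast_aeval_int, Int.cast_zero] at hm1
  rw [← Int.cast_lt (R := ℝ), cast_coeff_zero, Int.cast_zero] at h0
  obtain ⟨w, w', hlt, hw, hiff⟩ := exists_roots_of_aeval_neg hd hde hF hlead hm1
  have hw1 := ((hiff _).1 hm1).2
  have hw0 : w' ≤ 0 := by
    by_contra! hcon
    have := (hiff 0).2 ⟨lt_trans ((hiff _).1 hm1).1 (by norm_num), hcon⟩
    linarith
  have hw0' : w' < 0 := lt_of_le_of_ne hw0 hw.2.2.1.ne_zero
  rw [homEval_Tpow_mul_gam_neg_iff hde hF.1 hx hi] at hneg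
  have hjR : (1 : ℝ) ≤ j := by exact_mod_cast hj
  push_cast at hneg hw1
  have hg := gam_infty_nonpos hx hi
  rw [pslash_Tpow hF.1]
  refine ⟨⟨⟨hA.comp_X_add_C_mem hPA _, ?_, coeff_comp_X_add_C_pos hF.1 hlead _⟩,
    ⟨i, hi, rfl⟩, ?_, ?_⟩, _, _, sub_lt_sub_right hlt _, hw.comp_X_add_C _, ?_⟩
  · rw [← Int.cast_lt (R := ℝ), cast_coeff_zero, aeval_real_comp_X_add_C, Int.cast_zero, hiff]
    have := ((hiff _).1 hneg).1
    push_cast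
    constructor <;> linarith
  · rw [homEval_neg_iff hde (natDegree_comp_X_add_C_le hF.1 _) _
      (gam_one_zero_ne_zero hx hi).1, aeval_real_comp_X_add_C]
    push_cast
    exact hneg
  · have hjn' : (j : ℝ) ≤ cfN x i := by exact_mod_cast hjn
    rw [← Int.cast_lt (R := ℝ), cast_aeval_int, aeval_real_comp_X_add_C, Int.cast_zero]
    simp only [moeb_gam hx]
    change 0 < aeval ((cfN x i : ℝ) + _) P
    push_cast
    refine lt_of_le_of_ne (not_lt.1 fun hcon => ?_) fun hcon => ?_
    · have := ((hiff _).1 hcon).2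
      linarith
    · rcases (hw.2.2.2 _).1 hcon.symm with e | e <;> linarith
  · have : ⌊w' - ((-(j : ℤ) : ℤ) : ℝ)⌋ = (j : ℤ) - 1 := by
      rw [Int.floor_eq_iff]
      push_cast
      constructor <;> linarith
    rw [this]
    ring

theorem SimFlPairs_slash_mem {d : ℕ} (hd : 0 < d) (hde : Even d) {A : Set ℤ[X]}
    (hA : IsClassF d A) {x : ℝ} (hx : Irrational x) {P : ℤ[X]} {i : ℕ} (hi : 1 ≤ i)
    (h : (P, gam x i) ∈ SimFlPairs d A x) :
    ∃ w w' : ℝ, w < w' ∧ HasTwoIrratRoots P w w' ∧ 1 ≤ ⌊w'⌋ + 1 ∧ ⌊w'⌋ + 1 ≤ cfN x i ∧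
      (pslash d (Tpow (⌊w'⌋ + 1)) P, Tpow (-(⌊w'⌋ + 1)) * gam x i) ∈ RedTjPairs d A x := by
  obtain ⟨⟨hPA, h0, hlead⟩, -, hneg, hpos⟩ := h
  simp only at hPA hlead h0 hneg hpos
  have hF := hA.mem_Fd hPA
  rw [← Int.cast_lt (R := ℝ), cast_coeff_zero, Int.cast_zero] at h0
  obtain ⟨w, w', hlt, hw, hiff⟩ := exists_roots_of_aeval_neg hd hde hF hlead h0
  obtain ⟨hw0, hw0'⟩ := (hiff _).1 h0
  have hfl : 0 ≤ ⌊w'⌋ := Int.floor_nonneg.2 hw0'.le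
  have hflR : (0 : ℝ) ≤ ⌊w'⌋ := by exact_mod_cast hfl
  have hfl1 : (⌊w'⌋ : ℝ) < w' := lt_of_le_of_ne (Int.floor_le _) (hw.2.2.1.ne_int _).symm
  have hfl2 := Int.lt_floor_add_one w'
  have hn := one_le_cfN hx hi
  have hnR : (1 : ℝ) ≤ cfN x i := by exact_mod_cast hn
  rw [moeb_gam hx, ← Int.cast_lt (R := ℝ), cast_aeval_int, Int.cast_zero] at hpos
  change 0 < aeval (cfN x i : ℝ) P at hpos
  have hle : ⌊w'⌋ + 1 ≤ cfN x i := by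
    have : w' ≤ cfN x i := by
      by_contra! hcon
      have := (hiff _).2 ⟨by linarith, hcon⟩
      linarith
    exact Int.add_one_le_of_lt (by exact_mod_cast hfl1.trans_le this)
  refine ⟨w, w', hlt, hw, by omega, hle, ?_⟩
  obtain ⟨j, hj⟩ := Int.eq_ofNat_of_zero_le (by omega : 0 ≤ ⌊w'⌋ + 1)
  rw [pslash_Tpow hF.1]
  refine ⟨⟨hA.comp_X_add_C_mem hPA _, coeff_comp_X_add_C_pos hF.1 hlead _, ?_, ?_⟩,
    ⟨i, j, hi, by omega, by omega, by rw [hj]⟩, ?_⟩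
  · rw [← Int.cast_lt (R := ℝ), cast_aeval_int, aeval_real_comp_X_add_C, Int.cast_zero, hiff]
    push_cast
    constructor <;> linarith
  · rw [← Int.cast_lt (R := ℝ), cast_coeff_zero, aeval_real_comp_X_add_C, Int.cast_zero]
    push_cast
    refine lt_of_le_of_ne (not_lt.1 fun hcon => ?_) fun hcon => ?_
    · have := ((hiff _).1 hcon).2
      linarith
    · rcases (hw.2.2.2 _).1 hcon.symm with e | e <;> linarith
  · rw [homEval_Tpow_mul_gam_neg_iff hde (natDegree_comp_X_add_C_le hF.1 _) hx hi,
      aeval_real_comp_X_add_C, Int.cast_neg, neg_add_cancel_right]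
    exact (homEval_neg_iff hde hF.1 _ (gam_one_zero_ne_zero hx hi).1).1 hneg

theorem pslash_Tpow_neg_cancel {d : ℕ} {P : ℤ[X]} (hP : P.natDegree ≤ d) (n : ℤ) :
    pslash d (Tpow n) (pslash d (Tpow (-n)) P) = P := by
  rw [pslash_Tpow hP, pslash_Tpow (natDegree_comp_X_add_C_le hP _),
    comp_X_add_C_comp_X_add_C, neg_add_cancel, C_0, add_zero, comp_X]

open Classical in
/-- The map `(P, T^{-j}γ_i) ↦ (P|T^{-j}, γ_i)`, extended by the identity. -/
def redToSim (d : ℕ) (x : ℝ) (pg : ℤ[X] × Mat2) : ℤ[X] × Mat2 :=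
  if h : ∃ ij : ℕ × ℕ, 1 ≤ ij.1 ∧ pg.2 = Tpow (-(ij.2 : ℤ)) * gam x ij.1 then
    (pslash d (Tpow (-(h.choose.2 : ℤ))) pg.1, gam x h.choose.1)
  else pg

theorem redToSim_apply {x : ℝ} (hx : Irrational x) (d : ℕ) (P : ℤ[X]) {i : ℕ} (hi : 1 ≤ i)
    (j : ℕ) : redToSim d x (P, Tpow (-(j : ℤ)) * gam x i) =
      (pslash d (Tpow (-(j : ℤ))) P, gam x i) := by
  have h : ∃ ij : ℕ × ℕ, 1 ≤ ij.1 ∧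
      Tpow (-(j : ℤ)) * gam x i = Tpow (-(ij.2 : ℤ)) * gam x ij.1 := ⟨(i, j), hi, rfl⟩
  rw [redToSim, dif_pos h]
  obtain ⟨h1, h2⟩ := Tpow_mul_gam_inj hx hi h.choose_spec.2
  rw [← h1, ← h2]

/-- **the bijection `ψ` in the proof of Theorem 4.** For even `d > 0`,
`A` a `Γ`-equivalence class in `F_d` and `x` irrational, the map `ψ` sending
`(P, T^{-j}γ_i)` to `(P|T^{-j}, γ_i)` is a well-defined bijection from
`{(P,γ) ∈ A^Red × Γ(x)' : P(γ(∞)) < 0}` onto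
`{(P,γ) ∈ A^Sim × Γ(x) : P(γ(∞)) < 0 < P(⌊γ(x)⌋)}`, with inverse
`(P, γ_i) ↦ (P|T^{⌊w'_P⌋+1}, T^{-⌊w'_P⌋-1}γ_i)`, where `w'_P` denotes the larger real
root of `P` when `P(∞) > 0`. -/
theorem stmt5 (d : ℕ) (hd : 0 < d) (hde : Even d) (A : Set (Polynomial ℤ))
    (hA : IsClassF d A) (x : ℝ) (hx : Irrational x)
    (wpr : Polynomial ℤ → ℝ)
    (hwpr : ∀ (P : Polynomial ℤ) (w w' : ℝ), 0 < P.coeff d →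
      HasTwoIrratRoots P w w' → w < w' → wpr P = w') :
    ∃ ψ φ : Polynomial ℤ × Mat2 → Polynomial ℤ × Mat2,
      Set.BijOn ψ (RedTjPairs d A x) (SimFlPairs d A x) ∧
      (∀ pg ∈ RedTjPairs d A x, φ (ψ pg) = pg) ∧
      (∀ pg ∈ SimFlPairs d A x, ψ (φ pg) = pg) ∧
      (∀ (P : Polynomial ℤ) (i j : ℕ), 1 ≤ i → 1 ≤ j → (j : ℤ) ≤ cfN x i →
        (P, Tpow (-(j : ℤ)) * gam x i) ∈ RedTjPairs d A x →
        ψ (P, Tpow (-(j : ℤ)) * gam x i) = (pslash d (Tpow (-(j : ℤ))) P, gam x i)) ∧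
      (∀ (P : Polynomial ℤ) (i : ℕ), 1 ≤ i → (P, gam x i) ∈ SimFlPairs d A x →
        φ (P, gam x i) =
          (pslash d (Tpow (⌊wpr P⌋ + 1)) P, Tpow (-(⌊wpr P⌋ + 1)) * gam x i)) := by
  let φ : ℤ[X] × Mat2 → ℤ[X] × Mat2 := fun pg =>
    (pslash d (Tpow (⌊wpr pg.1⌋ + 1)) pg.1, Tpow (-(⌊wpr pg.1⌋ + 1)) * pg.2)
  have hψ : Set.MapsTo (redToSim d x) (RedTjPairs d A x) (SimFlPairs d A x) := by
    rintro ⟨P, M⟩ h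
    obtain ⟨i, j, hi, hj, hjn, rfl⟩ := h.2.1
    rw [redToSim_apply hx d P hi]
    exact (RedTjPairs_slash_mem hd hde hA hx hi hj hjn h).1
  have hφ : Set.MapsTo φ (SimFlPairs d A x) (RedTjPairs d A x) := by
    rintro ⟨P, M⟩ h
    obtain ⟨i, hi, rfl⟩ := h.2.1
    obtain ⟨w, w', hlt, hw, -, -, hmem⟩ := SimFlPairs_slash_mem hd hde hA hx hi h
    rwa [← hwpr P w w' h.1.2.2 hw hlt] at hmem
  have hleft : ∀ pg ∈ RedTjPairs d A x, φ (redToSim d x pg) = pg := by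
    rintro ⟨P, M⟩ h
    obtain ⟨i, j, hi, hj, hjn, rfl⟩ := h.2.1
    obtain ⟨hmem, w, w', hlt, hw, hfl⟩ := RedTjPairs_slash_mem hd hde hA hx hi hj hjn h
    rw [redToSim_apply hx d P hi]
    simp only [φ, hwpr _ w w' hmem.1.2.2 hw hlt, hfl,
      pslash_Tpow_neg_cancel (hA.mem_Fd h.1.1).1]
  have hright : ∀ pg ∈ SimFlPairs d A x, redToSim d x (φ pg) = pg := by
    rintro ⟨P, M⟩ h
    obtain ⟨i, hi, rfl⟩ := h.2.1
    obtain ⟨w, w', hlt, hw, h1, -, -⟩ := SimFlPairs_slash_mem hd hde hA hx hi h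
    obtain ⟨j, hj⟩ := Int.eq_ofNat_of_zero_le (zero_le_one.trans h1)
    simp only [φ, hwpr P w w' h.1.2.2 hw hlt, hj]
    rw [redToSim_apply hx d _ hi]
    have := pslash_Tpow_neg_cancel (hA.mem_Fd h.1.1).1 (-(j : ℤ))
    rw [neg_neg] at this
    rw [this]
  exact ⟨redToSim d x, φ, Set.InvOn.bijOn ⟨hleft, hright⟩ hψ hφ, hleft, hright,
    fun P i j hi _ _ _ => redToSim_apply hx d P hi j, fun P i _ _ => rfl⟩
end
end

section
/- Let d be a positive even integer, B a Γ₁-equivalence class in F_d (Γ₁ = PSL₂(ℤ)), and x an irrational real number. Then the map (P, γ) ↦ P|γ is a bijection from the set {(P, γ) ∈ B^Sim × Γ₁(x) : P(γ(∞)) < 0 < P(γ(x))} onto B⟨x⟩. -/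
open Polynomial Matrix

noncomputable section

section Slash

theorem sum_coeff_mul_pow_mul_pow {d : ℕ} {P : Polynomial ℤ} (hP : P.natDegree ≤ d) (u : ℝ)
    {v : ℝ} (hv : v ≠ 0) :
    ∑ j ∈ Finset.range (d + 1), (P.coeff j : ℝ) * u ^ j * v ^ (d - j) =
      v ^ d * aeval (u / v) P := by
  rw [aeval_eq_sum_range' (Nat.lt_succ_of_le hP), Finset.mul_sum]
  refine Finset.sum_congr rfl fun j hj => ?_
  have hj' : j ≤ d := Nat.lt_succ_iff.mp (Finset.mem_range.mp hj)
  rw [zsmul_eq_mul, div_pow, ← pow_sub_mul_pow v hj']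
  field_simp

theorem aeval_pslash (d : ℕ) (M : Mat2) (P : Polynomial ℤ) (y : ℝ) :
    aeval y (pslash d M P) = ∑ j ∈ Finset.range (d + 1), (P.coeff j : ℝ) *
      ((M 0 0 : ℝ) * y + M 0 1) ^ j * ((M 1 0 : ℝ) * y + M 1 1) ^ (d - j) := by
  simp [pslash, map_sum]

theorem aeval_pslash_eq {d : ℕ} {M : Mat2} {P : Polynomial ℤ} (hP : P.natDegree ≤ d) {y : ℝ}
    (hy : (M 1 0 : ℝ) * y + M 1 1 ≠ 0) :
    aeval y (pslash d M P) = ((M 1 0 : ℝ) * y + M 1 1) ^ d * aeval (moeb M y) P := by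
  rw [aeval_pslash, sum_coeff_mul_pow_mul_pow hP _ hy, moeb]

theorem homEval_cast {d : ℕ} {P : Polynomial ℤ} (hP : P.natDegree ≤ d) (r : ℤ) {t : ℤ}
    (ht : t ≠ 0) : (homEval d P r t : ℝ) = (t : ℝ) ^ d * aeval ((r : ℝ) / t) P := by
  rw [← sum_coeff_mul_pow_mul_pow hP _ (Int.cast_ne_zero.mpr ht)]
  simp [homEval]

theorem homEval_pos_iff {d : ℕ} (hde : Even d) {P : Polynomial ℤ} (hP : P.natDegree ≤ d) (r : ℤ)
    {t : ℤ} (ht : t ≠ 0) : 0 < homEval d P r t ↔ 0 < aeval ((r : ℝ) / t) P := by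
  have h : (0 : ℝ) < (t : ℝ) ^ d := hde.pow_pos (Int.cast_ne_zero.mpr ht)
  rw [← Int.cast_pos (R := ℝ), homEval_cast hP r ht, mul_pos_iff_of_pos_left h]

theorem homEval_mul_mul (d : ℕ) (P : Polynomial ℤ) (s r t : ℤ) :
    homEval d P (s * r) (s * t) = s ^ d * homEval d P r t := by
  rw [homEval, homEval, Finset.mul_sum]
  refine Finset.sum_congr rfl fun j hj => ?_
  have hj' : j ≤ d := Nat.lt_succ_iff.mp (Finset.mem_range.mp hj)
  rw [mul_pow, mul_pow, ← pow_sub_mul_pow s hj']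
  ring

theorem homEval_one_zero (d : ℕ) (P : Polynomial ℤ) : homEval d P 1 0 = P.coeff d := by
  rw [homEval, Finset.sum_range_succ, Finset.sum_eq_zero]
  · simp
  · intro j hj
    have : d - j ≠ 0 := by have := Finset.mem_range.mp hj; omega
    simp [this]

theorem natDegree_linear_pow_mul_le (a b c e : ℤ) {j d : ℕ} (hj : j ≤ d) :
    ((C a * X + C b) ^ j * (C c * X + C e) ^ (d - j)).natDegree ≤ d := by
  have h1 := natDegree_pow_le_of_le j (natDegree_linear_le (a := a) (b := b))
  have h2 := natDegree_pow_le_of_le (d - j) (natDegree_linear_le (a := c) (b := e))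
  exact (natDegree_mul_le_of_le h1 h2).trans (by omega)

theorem natDegree_pslash_le (d : ℕ) (M : Mat2) (P : Polynomial ℤ) :
    (pslash d M P).natDegree ≤ d := by
  refine natDegree_sum_le_of_forall_le _ _ fun j hj => ?_
  rw [mul_assoc]
  exact (natDegree_C_mul_le _ _).trans
    (natDegree_linear_pow_mul_le _ _ _ _ (Nat.lt_succ_iff.mp (Finset.mem_range.mp hj)))

theorem coeff_linear_pow_mul (a b c e : ℤ) {j d : ℕ} (hj : j ≤ d) :
    ((C a * X + C b) ^ j * (C c * X + C e) ^ (d - j)).coeff d = a ^ j * c ^ (d - j) := by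
  have h1 := natDegree_pow_le_of_le j (natDegree_linear_le (a := a) (b := b))
  have h2 := natDegree_pow_le_of_le (d - j) (natDegree_linear_le (a := c) (b := e))
  have h := coeff_mul_add_eq_of_natDegree_le h1 h2
  rw [coeff_pow_of_natDegree_le natDegree_linear_le,
    coeff_pow_of_natDegree_le natDegree_linear_le] at h
  rw [show j * 1 + (d - j) * 1 = d by omega] at h
  simpa only [mul_one, coeff_add, coeff_C_mul, coeff_X_one, coeff_C_succ, add_zero] using h

theorem coeff_pslash_top (d : ℕ) (M : Mat2) (P : Polynomial ℤ) :
    (pslash d M P).coeff d = homEval d P (M 0 0) (M 1 0) := by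
  rw [pslash, finsetSum_coeff, homEval]
  refine Finset.sum_congr rfl fun j hj => ?_
  rw [mul_assoc, coeff_C_mul,
    coeff_linear_pow_mul _ _ _ _ (Nat.lt_succ_iff.mp (Finset.mem_range.mp hj)), mul_assoc]

theorem coeff_pslash_zero (d : ℕ) (M : Mat2) (P : Polynomial ℤ) :
    (pslash d M P).coeff 0 = homEval d P (M 0 1) (M 1 1) := by
  simp [pslash, homEval, coeff_zero_eq_eval_zero, eval_finsetSum]

end Slash

section Moebius

theorem denom_ne_zero {M : Mat2} (hM : M.det = 1) {y : ℝ} (hy : Irrational y) :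
    (M 1 0 : ℝ) * y + M 1 1 ≠ 0 := by
  rw [det_fin_two] at hM
  intro h
  by_cases hc : M 1 0 = 0
  · have he : M 1 1 = 0 := by simpa [hc] using h
    simp [hc, he] at hM
  · exact ((hy.intCast_mul hc).add_intCast (M 1 1)).ne_zero h

theorem det_cast_eq {M : Mat2} (hM : M.det = 1) :
    (M 0 0 : ℝ) * M 1 1 - M 0 1 * M 1 0 = 1 := by
  rw [det_fin_two] at hM
  exact_mod_cast hM

theorem moeb_mul (M : Mat2) {N : Mat2} {y : ℝ}
    (hN : (N 1 0 : ℝ) * y + N 1 1 ≠ 0) : moeb (M * N) y = moeb M (moeb N y) := by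
  simp only [moeb, mul_apply, Fin.sum_univ_two]
  push_cast
  rw [← mul_div_mul_right _ ((M 1 0 : ℝ) * _ + _) hN]
  congr 1 <;> field_simp <;> ring

theorem moeb_one (y : ℝ) : moeb 1 y = y := by simp [moeb]

theorem moeb_adjugate_moeb {M : Mat2} (hM : M.det = 1) {y : ℝ} (hy : Irrational y) :
    moeb M.adjugate (moeb M y) = y := by
  rw [← moeb_mul _ (denom_ne_zero hM hy), adjugate_mul, hM, one_smul, moeb_one]

theorem Irrational.moeb {M : Mat2} (hM : M.det = 1) {y : ℝ} (hy : Irrational y) :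
    Irrational (moeb M y) := by
  rintro ⟨q, hq⟩
  refine hy ⟨((M.adjugate 0 0 : ℚ) * q + M.adjugate 0 1) /
    ((M.adjugate 1 0 : ℚ) * q + M.adjugate 1 1), ?_⟩
  rw [← moeb_adjugate_moeb hM hy, ← hq, _root_.moeb]
  push_cast
  rfl

theorem det_adjugate_eq_one {M : Mat2} (hM : M.det = 1) : M.adjugate.det = 1 := by
  simp [det_adjugate, hM]

theorem moeb_moeb_adjugate {M : Mat2} (hM : M.det = 1) {y : ℝ} (hy : Irrational y) :
    moeb M (moeb M.adjugate y) = y := by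
  rw [← moeb_mul _ (denom_ne_zero (det_adjugate_eq_one hM) hy), mul_adjugate, hM, one_smul,
    moeb_one]

theorem eq_of_aeval_irrational_eq {P Q : Polynomial ℤ}
    (h : ∀ y : ℝ, Irrational y → aeval y P = aeval y Q) : P = Q := by
  have hinf : {y : ℝ | Irrational y}.Infinite := fun h =>
    Cardinal.not_countable_real
      (((Set.countable_range ((↑) : ℚ → ℝ)).union h.countable).mono fun y _ => em _)
  apply map_injective (Int.castRingHom ℝ) Int.cast_injective
  refine eq_of_infinite_eval_eq _ _ (hinf.mono fun y hy => ?_)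
  simpa [aeval_def, eval_map] using h y hy

theorem pslash_pslash {d : ℕ} {M N : Mat2} (hM : M.det = 1) (hN : N.det = 1) {P : Polynomial ℤ}
    (hP : P.natDegree ≤ d) : pslash d N (pslash d M P) = pslash d (M * N) P := by
  refine eq_of_aeval_irrational_eq fun y hy => ?_
  have hd := denom_ne_zero hN hy
  rw [aeval_pslash_eq (natDegree_pslash_le d M P) hd,
    aeval_pslash_eq hP (denom_ne_zero hM (hy.moeb hN)),
    aeval_pslash_eq hP (denom_ne_zero (by rw [det_mul, hM, hN, one_mul]) hy),
    moeb_mul M hd, ← mul_assoc, ← mul_pow]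
  congr 2
  simp only [moeb, mul_apply, Fin.sum_univ_two]
  push_cast
  field_simp
  ring

theorem pslash_one {d : ℕ} {P : Polynomial ℤ} (hP : P.natDegree ≤ d) : pslash d 1 P = P := by
  refine eq_of_aeval_irrational_eq fun y hy => ?_
  rw [aeval_pslash_eq hP (denom_ne_zero det_one hy), moeb_one]
  simp

theorem pslash_adjugate_pslash {d : ℕ} {M : Mat2} (hM : M.det = 1) {P : Polynomial ℤ}
    (hP : P.natDegree ≤ d) : pslash d M.adjugate (pslash d M P) = P := by
  rw [pslash_pslash hM (det_adjugate_eq_one hM) hP, mul_adjugate, hM, one_smul, pslash_one hP]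

theorem pslash_pslash_adjugate {d : ℕ} {M : Mat2} (hM : M.det = 1) {P : Polynomial ℤ}
    (hP : P.natDegree ≤ d) : pslash d M (pslash d M.adjugate P) = P := by
  rw [pslash_pslash (det_adjugate_eq_one hM) hM hP, adjugate_mul, hM, one_smul, pslash_one hP]

theorem aeval_pslash_pos_iff {d : ℕ} (hde : Even d) {M : Mat2} (hM : M.det = 1)
    {P : Polynomial ℤ} (hP : P.natDegree ≤ d) {y : ℝ} (hy : Irrational y) :
    0 < aeval y (pslash d M P) ↔ 0 < aeval (moeb M y) P := by
  have hne := denom_ne_zero hM hy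
  rw [aeval_pslash_eq hP hne, mul_pos_iff_of_pos_left (hde.pow_pos hne)]

theorem aeval_pslash_ne_zero_of_denom_eq_zero {d : ℕ} {M : Mat2} (hM : M.det = 1)
    {P : Polynomial ℤ} (hPd : P.coeff d ≠ 0) {y : ℝ} (hy : (M 1 0 : ℝ) * y + M 1 1 = 0) :
    aeval y (pslash d M P) ≠ 0 := by
  have hnum : (M 0 0 : ℝ) * y + M 0 1 ≠ 0 := by
    intro h
    have h1 : (M 0 0 : ℝ) * M 1 1 - M 0 1 * M 1 0 = 0 := by
      linear_combination (M 0 0 : ℝ) * hy - (M 1 0 : ℝ) * h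
    exact one_ne_zero ((det_cast_eq hM).symm.trans h1)
  rw [aeval_pslash, hy, Finset.sum_range_succ, Finset.sum_eq_zero]
  · simpa using ⟨hPd, fun h => absurd h hnum⟩
  · intro j hj
    have : d - j ≠ 0 := by have := Finset.mem_range.mp hj; omega
    simp [this]

theorem pslash_mem_Fd {d : ℕ} {M : Mat2} (hM : M.det = 1) {P : Polynomial ℤ} (hP : P ∈ Fd d)
    (hPd : P.coeff d ≠ 0) : pslash d M P ∈ Fd d := by
  obtain ⟨hdeg, w, w', hne, hw, hw', hroots⟩ := hP
  have hadj := det_adjugate_eq_one hM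
  have key : ∀ v : ℝ, Irrational v → ∀ y : ℝ, (M 1 0 : ℝ) * y + M 1 1 ≠ 0 →
      (moeb M y = v ↔ y = moeb M.adjugate v) := by
    intro v hv y hy
    constructor
    · rintro rfl
      rw [← moeb_mul _ hy, adjugate_mul, hM, one_smul, moeb_one]
    · rintro rfl
      exact moeb_moeb_adjugate hM hv
  refine ⟨natDegree_pslash_le d M P, moeb M.adjugate w, moeb M.adjugate w', ?_, hw.moeb hadj,
    hw'.moeb hadj, fun y => ?_⟩
  · intro h
    apply hne
    rw [← moeb_moeb_adjugate hM hw, h, moeb_moeb_adjugate hM hw']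
  · by_cases hy : (M 1 0 : ℝ) * y + M 1 1 = 0
    · refine iff_of_false (aeval_pslash_ne_zero_of_denom_eq_zero hM hPd hy) ?_
      rintro (rfl | rfl)
      · exact denom_ne_zero hM (hw.moeb hadj) hy
      · exact denom_ne_zero hM (hw'.moeb hadj) hy
    · rw [aeval_pslash_eq hdeg hy, mul_eq_zero_iff_left (pow_ne_zero _ hy), hroots, key w hw y hy,
        key w' hw' y hy]

theorem IsClassF1.pslash_mem {d : ℕ} {B : Set (Polynomial ℤ)} (hB : IsClassF1 d B) {M : Mat2}
    (hM : M.det = 1) {P : Polynomial ℤ} (hP : P ∈ B) (hPd : P.coeff d ≠ 0) :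
    pslash d M P ∈ B := by
  obtain ⟨P₀, hP₀, rfl⟩ := hB
  obtain ⟨hPF, N, hN, rfl⟩ := hP
  exact ⟨pslash_mem_Fd hM hPF hPd, N * M, by rw [det_mul, hN, hM, one_mul],
    pslash_pslash hN hM hP₀.1⟩

theorem IsClassF1.subset_Fd {d : ℕ} {B : Set (Polynomial ℤ)} (hB : IsClassF1 d B) : B ⊆ Fd d := by
  obtain ⟨P₀, -, rfl⟩ := hB
  exact fun _ h => h.1

end Moebius

section NegativeContinuedFraction

/-- The numerators of the convergents of the negative continued fraction. -/
def ncfNum (x : ℝ) : ℕ → ℤ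
  | 0 => 1
  | 1 => ncfM x 0
  | i + 2 => ncfM x (i + 1) * ncfNum x (i + 1) - ncfNum x i

/-- The denominators of the convergents of the negative continued fraction. -/
def ncfDen (x : ℝ) : ℕ → ℤ
  | 0 => 0
  | 1 => 1
  | i + 2 => ncfM x (i + 1) * ncfDen x (i + 1) - ncfDen x i

theorem gamt_succ (x : ℝ) (i : ℕ) : gamt x (i + 1) =
    (-1 : ℤ) ^ i • !![ncfDen x i, -ncfNum x i; ncfDen x (i + 1), -ncfNum x (i + 1)] := by
  induction i with
  | zero =>
    ext a b
    fin_cases a <;> fin_cases b <;> simp [gamt, MS, Tpow, ncfDen, ncfNum]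
  | succ i ih =>
    rw [gamt, ih]
    ext a b
    fin_cases a <;> fin_cases b <;>
      simp [MS, Tpow, ncfDen, ncfNum, mul_apply, Fin.sum_univ_two] <;> ring

theorem det_gamt (x : ℝ) (i : ℕ) : (gamt x i).det = 1 := by
  induction i with
  | zero => simp [gamt]
  | succ i ih => rw [gamt, det_mul, ih, det_mul]; simp [MS, Tpow, det_fin_two]

theorem ncfNum_mul_ncfDen_sub (x : ℝ) (i : ℕ) :
    ncfNum x i * ncfDen x (i + 1) - ncfNum x (i + 1) * ncfDen x i = 1 := by
  induction i with
  | zero => simp [ncfNum, ncfDen]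
  | succ i ih => rw [ncfNum, ncfDen]; linear_combination ih

variable {x : ℝ}

theorem irrational_ncfX (hx : Irrational x) (i : ℕ) : Irrational (ncfX x i) := by
  induction i with
  | zero => exact hx
  | succ i ih =>
    rw [ncfX, one_div]
    exact (ih.intCast_sub _).inv

theorem ncfM_sub_pos (hx : Irrational x) (i : ℕ) : 0 < (ncfM x i : ℝ) - ncfX x i := by
  have h := Int.le_ceil (ncfX x i)
  exact sub_pos.mpr (h.lt_of_ne ((irrational_ncfX hx i).ne_int _))

theorem one_lt_ncfX_succ (hx : Irrational x) (i : ℕ) : 1 < ncfX x (i + 1) := by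
  rw [ncfX]
  refine (one_lt_one_div (ncfM_sub_pos hx i) ?_)
  have := Int.ceil_lt_add_one (ncfX x i)
  have hM : (ncfM x i : ℝ) = ⌈ncfX x i⌉ := rfl
  linarith [ncfM_sub_pos hx i]

theorem two_le_ncfM_succ (hx : Irrational x) (i : ℕ) : 2 ≤ ncfM x (i + 1) := by
  have h : (1 : ℤ) < ⌈ncfX x (i + 1)⌉ := Int.lt_ceil.mpr (by simpa using one_lt_ncfX_succ hx i)
  exact h

theorem ncfDen_lt_succ (hx : Irrational x) (i : ℕ) :
    0 ≤ ncfDen x i ∧ ncfDen x i < ncfDen x (i + 1) := by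
  induction i with
  | zero => simp [ncfDen]
  | succ i ih =>
    have := two_le_ncfM_succ hx i
    rw [ncfDen.eq_3]
    constructor <;> nlinarith

theorem le_ncfDen (hx : Irrational x) (i : ℕ) : (i : ℤ) ≤ ncfDen x i := by
  induction i with
  | zero => simp [ncfDen]
  | succ i ih =>
    have := (ncfDen_lt_succ hx i).2
    push_cast
    omega

theorem ncfDen_succ_pos (hx : Irrational x) (i : ℕ) : 0 < ncfDen x (i + 1) := by
  have := le_ncfDen hx (i + 1)
  push_cast at this
  omega

theorem ncfNum_sub_mul (hx : Irrational x) (i : ℕ) :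
    0 < ncfNum x (i + 1) - ncfDen x (i + 1) * x ∧
      ncfNum x i - ncfDen x i * x =
        ncfX x (i + 1) * (ncfNum x (i + 1) - ncfDen x (i + 1) * x) := by
  induction i with
  | zero =>
    have h : 0 < (ncfM x 0 : ℝ) - x := ncfM_sub_pos hx 0
    refine ⟨by simpa [ncfNum, ncfDen] using h, ?_⟩
    have hX : ncfX x 1 = 1 / ((ncfM x 0 : ℝ) - x) := rfl
    simp only [ncfNum, ncfDen, zero_add, hX]
    push_cast
    field_simp
    ring
  | succ i ih =>
    have h := ncfM_sub_pos hx (i + 1)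
    have hX : ncfX x (i + 2) = 1 / ((ncfM x (i + 1) : ℝ) - ncfX x (i + 1)) := rfl
    have hrec : (ncfNum x (i + 2) : ℝ) - ncfDen x (i + 2) * x =
        ((ncfM x (i + 1) : ℝ) - ncfX x (i + 1)) * (ncfNum x (i + 1) - ncfDen x (i + 1) * x) := by
      rw [ncfNum, ncfDen]
      push_cast
      linear_combination -ih.2
    refine ⟨hrec ▸ mul_pos h ih.1, ?_⟩
    rw [hrec, hX]
    field_simp

theorem ncfNum_sub_mul_le_one (hx : Irrational x) (i : ℕ) :
    (ncfNum x i : ℝ) - ncfDen x i * x ≤ 1 := by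
  induction i with
  | zero => simp [ncfNum, ncfDen]
  | succ i ih =>
    have h := ncfNum_sub_mul hx i
    have := one_lt_ncfX_succ hx i
    nlinarith

theorem lt_convergent (hx : Irrational x) (i : ℕ) :
    x < (ncfNum x (i + 1) : ℝ) / ncfDen x (i + 1) := by
  have h : (0 : ℝ) < ncfDen x (i + 1) := by exact_mod_cast ncfDen_succ_pos hx i
  rw [lt_div_iff₀ h]
  linarith [(ncfNum_sub_mul hx i).1]

theorem convergent_succ_lt (hx : Irrational x) (i : ℕ) :
    (ncfNum x (i + 2) : ℝ) / ncfDen x (i + 2) < (ncfNum x (i + 1) : ℝ) / ncfDen x (i + 1) := by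
  have h1 : (0 : ℝ) < ncfDen x (i + 1) := by exact_mod_cast ncfDen_succ_pos hx i
  have h2 : (0 : ℝ) < ncfDen x (i + 2) := by exact_mod_cast ncfDen_succ_pos hx (i + 1)
  have h : ((ncfNum x (i + 1) * ncfDen x (i + 2) - ncfNum x (i + 2) * ncfDen x (i + 1) : ℤ) : ℝ)
      = 1 := by exact_mod_cast ncfNum_mul_ncfDen_sub x (i + 1)
  push_cast at h
  rw [div_lt_div_iff₀ h2 h1]
  linarith

open Filter Topology in
theorem tendsto_convergent (hx : Irrational x) :
    Tendsto (fun i => (ncfNum x (i + 1) : ℝ) / ncfDen x (i + 1)) atTop (𝓝 x) := by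
  have hlim : Tendsto (fun i : ℕ => x + 1 / ((i : ℝ) + 1)) atTop (𝓝 x) := by
    simpa using tendsto_one_div_add_atTop_nhds_zero_nat.const_add x
  refine tendsto_of_tendsto_of_tendsto_of_le_of_le tendsto_const_nhds hlim
    (fun i => (lt_convergent hx i).le) fun i => ?_
  have hle : ((i : ℝ) + 1) ≤ ncfDen x (i + 1) := by exact_mod_cast le_ncfDen hx (i + 1)
  have hi : (0 : ℝ) < (i : ℝ) + 1 := by positivity
  have hden : (0 : ℝ) < ncfDen x (i + 1) := hi.trans_le hle
  have h1 := ncfNum_sub_mul_le_one hx (i + 1)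
  calc (ncfNum x (i + 1) : ℝ) / ncfDen x (i + 1)
      = x + (ncfNum x (i + 1) - ncfDen x (i + 1) * x) / ncfDen x (i + 1) := by
        field_simp; ring
    _ ≤ x + 1 / ncfDen x (i + 1) := by gcongr
    _ ≤ x + 1 / ((i : ℝ) + 1) := by gcongr

end NegativeContinuedFraction

section SignChange

theorem coeff_pslash_adjugate_gamt_zero {d : ℕ} (hde : Even d) (Q : Polynomial ℤ) (x : ℝ)
    (i : ℕ) : (pslash d (gamt x (i + 1)).adjugate Q).coeff 0 =
      homEval d Q (ncfNum x i) (ncfDen x i) := by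
  have h := homEval_mul_mul d Q ((-1) ^ i) (ncfNum x i) (ncfDen x i)
  rw [← pow_mul, (hde.mul_left i).neg_one_pow, one_mul] at h
  rw [coeff_pslash_zero, gamt_succ, ← h]
  simp [adjugate_fin_two]

theorem coeff_pslash_adjugate_gamt_top {d : ℕ} (hde : Even d) (Q : Polynomial ℤ) (x : ℝ)
    (i : ℕ) : (pslash d (gamt x (i + 1)).adjugate Q).coeff d =
      homEval d Q (ncfNum x (i + 1)) (ncfDen x (i + 1)) := by
  have h := homEval_mul_mul d Q ((-1) ^ (i + 1)) (ncfNum x (i + 1)) (ncfDen x (i + 1))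
  rw [← pow_mul, (hde.mul_left (i + 1)).neg_one_pow, one_mul] at h
  rw [coeff_pslash_top, gamt_succ, ← h]
  simp [adjugate_fin_two, pow_succ]

open Filter in
theorem tendsto_aeval_atBot {d : ℕ} (hd : 0 < d) {Q : Polynomial ℤ} (hQ : Q.natDegree ≤ d)
    (hlead : Q.coeff d < 0) : Tendsto (fun y : ℝ => aeval y Q) atTop atBot := by
  have hdeg : Q.natDegree = d := le_antisymm hQ (le_natDegree_of_ne_zero hlead.ne)
  have hinj : Function.Injective (Int.castRingHom ℝ) := Int.cast_injective
  have h := tendsto_atBot_of_leadingCoeff_nonpos (Q.map (Int.castRingHom ℝ))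
    (by rw [degree_map_eq_of_injective hinj]; exact natDegree_pos_iff_degree_pos.mp (hdeg ▸ hd))
    (by
      rw [leadingCoeff_map_of_injective hinj, leadingCoeff, hdeg]
      exact Int.cast_nonpos.mpr hlead.le)
  simpa [aeval_def, eval_map] using h

theorem exists_root_Ioo {Q : Polynomial ℤ} {a b : ℝ} (hab : a < b)
    (h : aeval a Q < 0 ∧ 0 < aeval b Q ∨ 0 < aeval a Q ∧ aeval b Q < 0) :
    ∃ y ∈ Set.Ioo a b, aeval y Q = 0 := by
  have hc : ContinuousOn (fun y : ℝ => aeval y Q) (Set.Icc a b) := Q.continuous_aeval.continuousOn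
  rcases h with h | h
  · exact intermediate_value_Ioo hab.le hc h
  · exact intermediate_value_Ioo' hab.le hc ⟨h.2, h.1⟩

/-- A polynomial with only two real roots, both irrational, which tends to `-∞` at `∞`
and is positive at `a < c`, is positive at rational points between. -/
theorem aeval_pos_of_between {d : ℕ} (hd : 0 < d) {Q : Polynomial ℤ} (hQ : Q ∈ Fd d)
    (hlead : Q.coeff d < 0) {a c : ℝ} {b : ℚ} (hab : a < b) (hbc : b < c)
    (ha : 0 < aeval a Q) (hc : 0 < aeval c Q) : 0 < aeval (b : ℝ) Q := by
  obtain ⟨hdeg, w, w', -, hw, hw', hroots⟩ := hQ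
  by_contra! hb
  have hb' : aeval (b : ℝ) Q < 0 := by
    refine hb.lt_of_ne fun h => ?_
    rcases (hroots b).mp h with h | h
    · exact hw ⟨b, h⟩
    · exact hw' ⟨b, h⟩
  obtain ⟨e, he, hce⟩ := (((tendsto_aeval_atBot hd hdeg hlead).eventually_lt_atBot 0).and
    (Filter.eventually_gt_atTop c)).exists
  obtain ⟨y₁, h₁, hy₁⟩ := exists_root_Ioo hab (Or.inr ⟨ha, hb'⟩)
  obtain ⟨y₂, h₂, hy₂⟩ := exists_root_Ioo hbc (Or.inl ⟨hb', hc⟩)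
  obtain ⟨y₃, h₃, hy₃⟩ := exists_root_Ioo hce (Or.inr ⟨hc, he⟩)
  have h12 : y₁ < y₂ := h₁.2.trans h₂.1
  have h23 : y₂ < y₃ := h₂.2.trans h₃.1
  rcases (hroots y₁).mp hy₁ with e₁ | e₁ <;> rcases (hroots y₂).mp hy₂ with e₂ | e₂ <;>
    rcases (hroots y₃).mp hy₃ with e₃ | e₃ <;> linarith

variable {d : ℕ} {Q : Polynomial ℤ} {x : ℝ}

theorem homEval_convergent_pos_succ (hd : 0 < d) (hde : Even d) (hQ : Q ∈ Fd d)
    (hlead : Q.coeff d < 0) (hx : Irrational x) (hQx : 0 < aeval x Q) (i : ℕ)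
    (h : 0 < homEval d Q (ncfNum x i) (ncfDen x i)) :
    0 < homEval d Q (ncfNum x (i + 1)) (ncfDen x (i + 1)) := by
  cases i with
  | zero =>
    rw [ncfNum, ncfDen, homEval_one_zero] at h
    exact absurd h hlead.not_gt
  | succ i =>
    rw [homEval_pos_iff hde hQ.1 _ (ncfDen_succ_pos hx _).ne'] at h ⊢
    have := aeval_pos_of_between (b := (ncfNum x (i + 2) : ℚ) / ncfDen x (i + 2)) hd hQ hlead
      (by exact_mod_cast lt_convergent hx (i + 1)) (by exact_mod_cast convergent_succ_lt hx i) hQx h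
    exact_mod_cast this

theorem homEval_convergent_pos_of_le (hd : 0 < d) (hde : Even d) (hQ : Q ∈ Fd d)
    (hlead : Q.coeff d < 0) (hx : Irrational x) (hQx : 0 < aeval x Q) {i j : ℕ} (hij : i ≤ j)
    (h : 0 < homEval d Q (ncfNum x i) (ncfDen x i)) :
    0 < homEval d Q (ncfNum x j) (ncfDen x j) := by
  induction j, hij using Nat.le_induction with
  | base => exact h
  | succ j _ ih => exact homEval_convergent_pos_succ hd hde hQ hlead hx hQx j ih

theorem exists_homEval_convergent_pos (hde : Even d) (hQ : Q ∈ Fd d) (hx : Irrational x)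
    (hQx : 0 < aeval x Q) : ∃ i, 0 < homEval d Q (ncfNum x i) (ncfDen x i) := by
  have h := (Q.continuous_aeval (A := ℝ)).continuousAt.tendsto.comp (tendsto_convergent hx)
  obtain ⟨i, hi⟩ := (h.eventually_const_lt hQx).exists
  exact ⟨i + 1, (homEval_pos_iff hde hQ.1 _ (ncfDen_succ_pos hx _).ne').mpr hi⟩

theorem homEval_convergent_ne_zero (hQ : Q ∈ Fd d) (hlead : Q.coeff d ≠ 0) (hx : Irrational x)
    (i : ℕ) : homEval d Q (ncfNum x i) (ncfDen x i) ≠ 0 := by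
  cases i with
  | zero => rwa [ncfNum, ncfDen, homEval_one_zero]
  | succ i =>
    obtain ⟨hdeg, w, w', -, hw, hw', hroots⟩ := hQ
    have hden := (ncfDen_succ_pos hx i).ne'
    intro h
    rw [← Int.cast_eq_zero (α := ℝ), homEval_cast hdeg _ hden,
      mul_eq_zero_iff_left (pow_ne_zero _ (Int.cast_ne_zero.mpr hden)), hroots] at h
    rcases h with h | h
    · exact hw ⟨(ncfNum x (i + 1) : ℚ) / ncfDen x (i + 1), by exact_mod_cast h⟩
    · exact hw' ⟨(ncfNum x (i + 1) : ℚ) / ncfDen x (i + 1), by exact_mod_cast h⟩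

theorem exists_homEval_convergent_sign_change (hde : Even d) (hQ : Q ∈ Fd d)
    (hlead : Q.coeff d < 0) (hx : Irrational x) (hQx : 0 < aeval x Q) :
    ∃ i, homEval d Q (ncfNum x i) (ncfDen x i) < 0 ∧
      0 < homEval d Q (ncfNum x (i + 1)) (ncfDen x (i + 1)) := by
  classical
  have hex := exists_homEval_convergent_pos hde hQ hx hQx
  cases hi : Nat.find hex with
  | zero =>
    have h := Nat.find_spec hex
    rw [hi, ncfNum, ncfDen, homEval_one_zero] at h
    exact absurd h hlead.not_gt
  | succ i =>
    refine ⟨i, ?_, hi ▸ Nat.find_spec hex⟩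
    exact (not_lt.mp (Nat.find_min hex (hi ▸ i.lt_succ_self))).lt_of_ne
      (homEval_convergent_ne_zero hQ hlead.ne hx i)

end SignChange

/-- **Theorem 5 of the paper.** For even `d > 0`, `B` a `Γ₁`-equivalence
class in `F_d` and `x` irrational, the map `(P,γ) ↦ P|γ` is a bijection from
`{(P,γ) ∈ B^Sim × Γ₁(x) : P(γ(∞)) < 0 < P(γ(x))}` onto `B⟨x⟩`. -/
theorem stmt6 (d : ℕ) (hd : 0 < d) (hde : Even d) (B : Set (Polynomial ℤ))
    (hB : IsClassF1 d B) (x : ℝ) (hx : Irrational x) :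
    Set.BijOn (fun pg : Polynomial ℤ × Mat2 => pslash d pg.2 pg.1)
      {pg : Polynomial ℤ × Mat2 | pg.1 ∈ PSim d B ∧ pg.2 ∈ Gamma1Set x ∧
        homEval d pg.1 (pg.2 0 0) (pg.2 1 0) < 0 ∧
        0 < Polynomial.aeval (moeb pg.2 x) pg.1}
      (Px d B x) := by
  have maps : Set.MapsTo (fun pg : Polynomial ℤ × Mat2 => pslash d pg.2 pg.1)
      {pg : Polynomial ℤ × Mat2 | pg.1 ∈ PSim d B ∧ pg.2 ∈ Gamma1Set x ∧
        homEval d pg.1 (pg.2 0 0) (pg.2 1 0) < 0 ∧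
        0 < Polynomial.aeval (moeb pg.2 x) pg.1} (Px d B x) := by
    rintro ⟨P, γ⟩ ⟨⟨hPB, -, hPd⟩, ⟨i, -, rfl : γ = _⟩, hneg, hpos⟩
    have hdet := det_gamt x i
    refine ⟨hB.pslash_mem hdet hPB hPd.ne', ?_, ?_⟩
    · rwa [coeff_pslash_top]
    · rwa [aeval_pslash_pos_iff hde hdet (hB.subset_Fd hPB).1 hx]
  refine ⟨maps, ?_, ?_⟩
  · rintro ⟨P, γ⟩ h ⟨P', γ'⟩ h' (heq : pslash d γ P = pslash d γ' P')
    obtain ⟨hQB, hlead, hQx⟩ := maps h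
    obtain ⟨⟨hPB, hP0, hPd⟩, ⟨i, hi, rfl : γ = _⟩, -⟩ := h
    obtain ⟨⟨hPB', hP0', hPd'⟩, ⟨j, hj, rfl : γ' = _⟩, -⟩ := h'
    obtain ⟨i, rfl⟩ := Nat.exists_eq_add_of_le' hi
    obtain ⟨j, rfl⟩ := Nat.exists_eq_add_of_le' hj
    have hP := pslash_adjugate_pslash (det_gamt x (i + 1)) (hB.subset_Fd hPB).1
    have hP' := pslash_adjugate_pslash (det_gamt x (j + 1)) (hB.subset_Fd hPB').1
    rw [← heq] at hP'
    dsimp only at hP0 hPd hP0' hPd' hQB hlead hQx hP hP'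
    generalize pslash d (gamt x (i + 1)) P = Q at *
    have mono := fun {k l : ℕ} => homEval_convergent_pos_of_le (i := k) (j := l) hd hde
      (hB.subset_Fd hQB) hlead hx hQx
    rw [← hP, coeff_pslash_adjugate_gamt_zero hde] at hP0
    rw [← hP, coeff_pslash_adjugate_gamt_top hde] at hPd
    rw [← hP', coeff_pslash_adjugate_gamt_zero hde] at hP0'
    rw [← hP', coeff_pslash_adjugate_gamt_top hde] at hPd'
    have hij : i = j := by
      rcases lt_trichotomy i j with hlt | rfl | hlt
      · exact absurd hP0' (mono hlt hPd).not_gt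
      · rfl
      · exact absurd hP0 (mono hlt hPd').not_gt
    subst hij
    rw [← hP, hP']
  · rintro Q ⟨hQB, hlead, hQx⟩
    have hQ := hB.subset_Fd hQB
    obtain ⟨i, hi, hi'⟩ := exists_homEval_convergent_sign_change hde hQ hlead hx hQx
    have hdet := det_gamt x (i + 1)
    have hback := pslash_pslash_adjugate hdet hQ.1
    refine ⟨(pslash d (gamt x (i + 1)).adjugate Q, gamt x (i + 1)),
      ⟨⟨hB.pslash_mem (det_adjugate_eq_one hdet) hQB hlead.ne, ?_, ?_⟩,
        ⟨i + 1, Nat.le_add_left 1 i, rfl⟩, ?_, ?_⟩, hback⟩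
    · rwa [coeff_pslash_adjugate_gamt_zero hde]
    · rwa [coeff_pslash_adjugate_gamt_top hde]
    · rw [← coeff_pslash_top, hback]
      exact hlead
    · rw [← aeval_pslash_pos_iff hde hdet (natDegree_pslash_le _ _ _) hx, hback]
      exact hQx
end
end
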